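/- Let c be a real constant with c ≠ 0, let γ be a complex number with γ³ = c, and let θ : ℝ → ℝ be twice differentiable with θ''(t) = 4c·sin(θ(t)) for all t. Set E = θ'(0)²/2 + 4c·cos(θ(0)) and a = 2c − E²/(6c), and define q : ℝ → ℂ by q(t) = γ·(exp(i·θ(t)) − E/(6c)). Then q''(t) = 6γ²·q(t)² + a·γ for all t ∈ ℝ. -/

import Mathlib

/-- The energy of the pendulum `θ'' = 4c sin θ` is conserved. -/
theorem pendulum_energy_eq (c : ℝ) (θ θ' : ℝ → ℝ)
    (hθ : ∀ t, HasDerivAt θ (θ' t) t)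
    (hθ' : ∀ t, HasDerivAt θ' (4 * c * Real.sin (θ t)) t) (t s : ℝ) :
    θ' t ^ 2 / 2 + 4 * c * Real.cos (θ t) = θ' s ^ 2 / 2 + 4 * c * Real.cos (θ s) := by
  have h : ∀ x, HasDerivAt (fun x => θ' x ^ 2 / 2 + 4 * c * Real.cos (θ x)) 0 x := fun x => by
    refine ((((hθ' x).pow 2).div_const 2).add ((hθ x).cos.const_mul (4 * c))).congr_deriv ?_
    push_cast
    ring
  exact is_const_of_deriv_eq_zero (fun x => (h x).differentiableAt) (fun x => (h x).deriv) t s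

/-- The pendulum in Weierstrass form: if `θ'' = 4c sin θ`, `E = θ'(0)²/2 + 4c cos(θ(0))`,
`a = 2c − E²/(6c)` and `γ³ = c ≠ 0`, then `q(t) = γ(exp(iθ(t)) − E/(6c))` satisfies
`q'' = 6γ² q² + aγ`. -/
theorem pendulum_weierstrass_form (c : ℝ) (hc : c ≠ 0) (γ : ℂ) (hγ : γ ^ 3 = (c : ℂ))
    (θ θ' θ'' : ℝ → ℝ)
    (hθ : ∀ t, HasDerivAt θ (θ' t) t)
    (hθ' : ∀ t, HasDerivAt θ' (θ'' t) t)
    (heq : ∀ t, θ'' t = 4 * c * Real.sin (θ t))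
    (E : ℝ) (hE : E = θ' 0 ^ 2 / 2 + 4 * c * Real.cos (θ 0))
    (a : ℂ) (ha : a = 2 * (c : ℂ) - (E : ℂ) ^ 2 / (6 * (c : ℂ)))
    (q : ℝ → ℂ)
    (hq : ∀ t, q t = γ * (Complex.exp (Complex.I * (θ t)) - (E : ℂ) / (6 * (c : ℂ)))) :
    ∃ q' : ℝ → ℂ, (∀ t, HasDerivAt q (q' t) t) ∧
      ∀ t, HasDerivAt q' (6 * γ ^ 2 * (q t) ^ 2 + a * γ) t := by
  have hc' : (c : ℂ) ≠ 0 := Complex.ofReal_ne_zero.mpr hc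
  have hu : ∀ t, HasDerivAt (fun t => Complex.exp (Complex.I * (θ t)))
      (Complex.exp (Complex.I * (θ t)) * (Complex.I * (θ' t))) t := fun t =>
    ((hθ t).ofReal_comp.const_mul Complex.I).cexp
  refine ⟨fun t => γ * (Complex.exp (Complex.I * (θ t)) * (Complex.I * (θ' t))),
    fun t => ?_, fun t => ?_⟩
  · rw [funext hq]
    exact ((hu t).sub_const _).const_mul γ
  · refine (((hu t).mul ((hθ' t).ofReal_comp.const_mul Complex.I)).const_mul γ).congr_deriv ?_
    have energy : (θ' t : ℂ) ^ 2 / 2 + 4 * c * Complex.cos (θ t) = E := by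
      have h := pendulum_energy_eq c θ θ' hθ (fun s => heq s ▸ hθ' s) t 0
      rw [← hE] at h
      exact_mod_cast congrArg Complex.ofReal h
    have hsc := Complex.sin_sq_add_cos_sq (θ t : ℂ)
    have hexp : Complex.exp (Complex.I * (θ t)) =
        Complex.cos (θ t) + Complex.sin (θ t) * Complex.I := by
      rw [mul_comm, Complex.exp_mul_I]
    have shift : 6 * γ ^ 2 * (q t) ^ 2 + a * γ = γ * (6 * c * Complex.exp (Complex.I * (θ t)) ^ 2
        - 2 * E * Complex.exp (Complex.I * (θ t)) + 2 * c) := by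
      rw [hq, ha, mul_pow]
      have hγ4 : γ ^ 2 * γ ^ 2 = c * γ := by rw [← hγ]; ring
      rw [← mul_assoc, mul_assoc 6, hγ4]
      field_simp
      ring
    rw [shift, heq, hexp, ← energy]
    push_cast
    linear_combination 2 * γ * c * hsc -
      γ * (2 * c * Complex.sin (θ t) ^ 2 - (θ' t : ℂ) ^ 2 *
        (Complex.cos (θ t) + Complex.sin (θ t) * Complex.I)) * Complex.I_sq
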